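/- arXiv:1406.5996 — 2 statements merged into one kernel-verified Lean document; each statement's English description precedes it below -/
import Mathlib

section
/- Let p be a generic point of ℝ^{3n} with n ≥ 5, let G be a graph on vertices v_1,...,v_n, and let Y = Y^p be the family of concentric cylinders induced by p. Let (ω,λ) be an equilibrium stress for (G,p) on Y, and let (G,q) be a framework on Y which is equivalent to (G,p). Then (ω,λ) is an equilibrium stress for (G,q) on Y. Furthermore, if rank Ω_Y(ω,λ) = 3n − 6, then (G,p) is globally rigid on Y. -/
open Finset

/-- The `n×n` matrix `Ω(ω)` with off-diagonal entries `-ω i j` and diagonal entries `∑ k, ω i k`. -/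
def omegaMat {n : ℕ} (ω : Fin n → Fin n → ℝ) : Matrix (Fin n) (Fin n) ℝ :=
  fun i j => if i = j then ∑ k, ω i k else -ω i j

/-- The `3n×3n` stress matrix `Ω_Y(ω,λ) = diag(Ω+Λ, Ω+Λ, Ω)` on a family of concentric
cylinders, indexed by `Fin 3 × Fin n` (coordinate block × vertex). -/
def stressMatY {n : ℕ} (ω : Fin n → Fin n → ℝ) (lam : Fin n → ℝ) :
    Matrix (Fin 3 × Fin n) (Fin 3 × Fin n) ℝ :=
  fun r c => if r.1 = c.1 then
      omegaMat ω r.2 c.2 + (if r.2 = c.2 ∧ r.1 ≠ 2 then lam r.2 else 0)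
    else 0

/-- `(ω,λ)` is an equilibrium stress for `(G,p)` on the family of concentric cylinders:
`∑_j ω_ij (p_i − p_j) + λ_i (x_i, y_i, 0) = 0` for all `i`. -/
def IsEquilStressY {n : ℕ} (p : Fin n → Fin 3 → ℝ)
    (ω : Fin n → Fin n → ℝ) (lam : Fin n → ℝ) : Prop :=
  ∀ i, ∀ a : Fin 3,
    (∑ j, ω i j * (p i a - p j a)) + lam i * (if a = 2 then 0 else p i a) = 0

/-- `(ω,λ)` is a stress for the graph `G`: `ω` is symmetric and supported on the edges. -/
def IsStress {n : ℕ} (G : SimpleGraph (Fin n)) (ω : Fin n → Fin n → ℝ) : Prop :=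
  (∀ i j, ω i j = ω j i) ∧ (∀ i j, ¬ G.Adj i j → ω i j = 0)

/-- The `6 × 3n` configuration matrix `C_Y(G,p)` for a framework on a family of
concentric cylinders, with rows `(x|0|0), (0|y|0), (0|0|z), (y|0|0), (0|x|0), (0|0|1)`. -/
def configMatY {n : ℕ} (p : Fin n → Fin 3 → ℝ) : Matrix (Fin 6) (Fin 3 × Fin n) ℝ :=
  Matrix.of ![
    fun c => if c.1 = 0 then p c.2 0 else 0,
    fun c => if c.1 = 1 then p c.2 1 else 0,
    fun c => if c.1 = 2 then p c.2 2 else 0,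
    fun c => if c.1 = 0 then p c.2 1 else 0,
    fun c => if c.1 = 1 then p c.2 0 else 0,
    fun c => if c.1 = 2 then 1 else 0]

section TangentTransfer

variable {k R B K : Type*} [Field K] [CharZero K]

/-- A field extension in characteristic zero is formally smooth. -/
theorem Algebra.FormallySmooth.of_field_charZero [Field k] [Algebra k K] :
    Algebra.FormallySmooth k K := by
  have : CharZero k := (algebraMap k K).charZero
  obtain ⟨s, hs⟩ := exists_isTranscendenceBasis k K
  have : Algebra.IsAlgebraic (IntermediateField.adjoin k (Set.range ((↑) : s → K))) K :=
    hs.isAlgebraic_field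
  exact .of_algebraicIndependent_of_isSeparable hs.1

/-- A field of characteristic zero is formally smooth over each of its subrings. -/
theorem Algebra.FormallySmooth.of_faithfulSMul_charZero [CommRing R] [Algebra R K]
    [FaithfulSMul R K] : Algebra.FormallySmooth R K := by
  have := IsDomain.of_faithfulSMul R K
  let := FractionRing.liftAlgebra R K
  have : Algebra.FormallySmooth R (FractionRing R) := .of_isLocalization (nonZeroDivisors R)
  have : Algebra.FormallySmooth (FractionRing R) K := .of_field_charZero
  exact .comp R (FractionRing R) K

/-- A square-zero extension `π : B → K` of a field of characteristic zero has a section extending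
any given lift `g : R → B` of an injective homomorphism `f : R → K`. -/
theorem RingHom.exists_section_of_injective [CommRing R] [CommRing B] (f : R →+* K)
    (hf : Function.Injective f) (g : R →+* B) (π : B →+* K) (hπ : Function.Surjective π)
    (hsq : ∀ x y, π x = 0 → π y = 0 → x * y = 0) (hfg : ∀ a, π (g a) = f a) :
    ∃ ψ : K →+* B, (∀ x, π (ψ x) = x) ∧ ∀ a, ψ (f a) = g a := by
  let := f.toAlgebra
  let := g.toAlgebra
  have : FaithfulSMul R K := (faithfulSMul_iff_algebraMap_injective R K).2 hf
  have := Algebra.FormallySmooth.of_faithfulSMul_charZero (R := R) (K := K)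
  let π' : B →ₐ[R] K := { π with commutes' := hfg }
  have hker : IsNilpotent (RingHom.ker (π' : B →+* K)) :=
    ⟨2, by
      rw [pow_two, Ideal.zero_eq_bot, ← le_bot_iff, Ideal.mul_le]
      exact fun x hx y hy => hsq x y hx hy⟩
  let ψ := Algebra.FormallySmooth.liftOfSurjective (AlgHom.id R K) π' hπ hker
  exact ⟨ψ, Algebra.FormallySmooth.liftOfSurjective_apply (AlgHom.id R K) π' hπ hker,
    fun a => ψ.commutes a⟩

open MvPolynomial in
/-- Every tangent vector `v` at `q` has a companion `u` at a generic point `p` such that every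
rational polynomial agreeing at `p` and `q` has the same derivative along `u` and along `v`. -/
theorem AlgebraicIndependent.exists_tangent [Algebra ℚ K] {σ : Type*} {p : σ → K}
    (hp : AlgebraicIndependent ℚ p) (q v : σ → K) :
    ∃ u : σ → K, ∀ P : MvPolynomial σ ℚ, aeval p P = aeval q P →
      aeval (fun s => (TrivSqZeroExt.inl (p s) + TrivSqZeroExt.inr (u s) : DualNumber K)) P =
      aeval (fun s => (TrivSqZeroExt.inl (q s) + TrivSqZeroExt.inr (v s) : DualNumber K)) P := by
  let A := AlgHom.equalizer (aeval p : MvPolynomial σ ℚ →ₐ[ℚ] K) (aeval q)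
  let γ : MvPolynomial σ ℚ →ₐ[ℚ] DualNumber K :=
    aeval fun s => TrivSqZeroExt.inl (q s) + TrivSqZeroExt.inr (v s)
  let π : DualNumber K →ₐ[ℚ] K := TrivSqZeroExt.fstHom ℚ K K
  have hγ : ∀ P, π (γ P) = aeval q P := fun P => by
    suffices π.comp γ = aeval q from DFunLike.congr_fun this P
    ext s
    simp [π, γ]
  obtain ⟨ψ, hψ, hψγ⟩ := RingHom.exists_section_of_injective
    ((aeval p : MvPolynomial σ ℚ →ₐ[ℚ] K).comp A.val).toRingHom
    (show Function.Injective (aeval p ∘ Subtype.val) from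
      Function.Injective.comp hp Subtype.val_injective)
    (γ.comp A.val).toRingHom π.toRingHom (fun x => ⟨TrivSqZeroExt.inl x, rfl⟩)
    (fun x y hx hy => by
      change x.fst = 0 at hx
      change y.fst = 0 at hy
      ext <;> simp [hx, hy])
    (fun P => (hγ P).trans P.2.symm)
  refine ⟨fun s => (ψ (p s)).snd, fun P hP => ?_⟩
  have key : ψ.toRatAlgHom (aeval p P) = γ P := hψγ ⟨P, hP⟩
  rw [← show γ P = _ from rfl, ← key]
  refine DFunLike.congr_fun (?_ : _ = ψ.toRatAlgHom.comp (aeval p)) P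
  ext s
  · simpa using (show (ψ (p s)).fst = p s from hψ (p s)).symm
  · simp

end TangentTransfer

section CylinderStress

variable {n : ℕ} {G : SimpleGraph (Fin n)} {p q : Fin n → Fin 3 → ℝ}
  {ω : Fin n → Fin n → ℝ} {lam : Fin n → ℝ}

theorem sum_mul_sub_mul_sub_of_symm (hω : ∀ i j, ω i j = ω j i) (x y : Fin n → ℝ) :
    ∑ i, ∑ j, ω i j * ((x i - x j) * (y i - y j)) =
      2 * ∑ i, y i * ∑ j, ω i j * (x i - x j) := by
  have h : ∑ i, ∑ j, y j * (ω i j * (x i - x j)) = - ∑ i, ∑ j, y i * (ω i j * (x i - x j)) := by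
    rw [Finset.sum_comm, ← Finset.sum_neg_distrib]
    refine Finset.sum_congr rfl fun i _ => ?_
    rw [← Finset.sum_neg_distrib]
    refine Finset.sum_congr rfl fun j _ => ?_
    rw [hω]
    ring
  have h' : ∑ i, y i * ∑ j, ω i j * (x i - x j) = ∑ i, ∑ j, y i * (ω i j * (x i - x j)) := by
    simp_rw [Finset.mul_sum]
  rw [h', two_mul]
  nth_rewrite 2 [← neg_neg (∑ i, ∑ j, y i * (ω i j * (x i - x j)))]
  rw [← h, ← sub_eq_add_neg, ← Finset.sum_sub_distrib]
  refine Finset.sum_congr rfl fun i _ => ?_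
  rw [← Finset.sum_sub_distrib]
  exact Finset.sum_congr rfl fun j _ => by ring

/-- Pairing the equilibrium residual of a stress with a velocity `v` gives the stress-weighted sum
of the derivatives along `v` of the edge and cylinder constraints. -/
theorem two_mul_sum_residual_eq (hω : ∀ i j, ω i j = ω j i) (q v : Fin n → Fin 3 → ℝ) :
    2 * ∑ a, ∑ i, v i a *
        ((∑ j, ω i j * (q i a - q j a)) + lam i * (if a = 2 then 0 else q i a)) =
      (∑ i, ∑ j, ω i j * ∑ a, (q i a - q j a) * (v i a - v j a)) +
        2 * ∑ i, lam i * (q i 0 * v i 0 + q i 1 * v i 1) := by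
  simp only [mul_add (v _ _), Finset.sum_add_distrib, mul_add (2 : ℝ)]
  congr 1
  · rw [Finset.mul_sum]
    simp_rw [← sum_mul_sub_mul_sub_of_symm hω, Finset.mul_sum]
    rw [Finset.sum_comm]
    exact Finset.sum_congr rfl fun i _ => Finset.sum_comm
  · rw [Finset.sum_comm]
    congr 1
    refine Finset.sum_congr rfl fun i _ => ?_
    simp [Fin.sum_univ_three]
    ring

open MvPolynomial in
theorem IsEquilStressY.of_equivalent
    (hgen : AlgebraicIndependent ℚ (fun c : Fin n × Fin 3 => p c.1 c.2))
    (hω : IsStress G ω) (hequilp : IsEquilStressY p ω lam)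
    (hq : ∀ i, (q i 0) ^ 2 + (q i 1) ^ 2 = (p i 0) ^ 2 + (p i 1) ^ 2)
    (hequiv : ∀ i j, G.Adj i j →
      ∑ a, (p i a - p j a) ^ 2 = ∑ a, (q i a - q j a) ^ 2) :
    IsEquilStressY q ω lam := by
  let v : Fin n → Fin 3 → ℝ := fun i a =>
    (∑ j, ω i j * (q i a - q j a)) + lam i * (if a = 2 then 0 else q i a)
  obtain ⟨u, hu⟩ := hgen.exists_tangent (fun c => q c.1 c.2) (fun c => v c.1 c.2)
  have hcyl : ∀ i, p i 0 * u (i, 0) + p i 1 * u (i, 1) = q i 0 * v i 0 + q i 1 * v i 1 := by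
    intro i
    have h := congrArg TrivSqZeroExt.snd
      (hu (X (i, 0) ^ 2 + X (i, 1) ^ 2) (by simpa using (hq i).symm))
    simp [pow_two] at h
    linarith
  have hedge : ∀ i j, G.Adj i j → ∑ a, (p i a - p j a) * (u (i, a) - u (j, a)) =
      ∑ a, (q i a - q j a) * (v i a - v j a) := by
    intro i j hij
    have h := congrArg TrivSqZeroExt.snd
      (hu (∑ a, (X (i, a) - X (j, a)) ^ 2) (by simpa using hequiv i j hij))
    simp [pow_two, Fin.sum_univ_three] at h
    simp only [Fin.sum_univ_three]
    linarith
  have hsum : ∑ a, ∑ i, v i a * v i a = 0 := by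
    have hqv := two_mul_sum_residual_eq (lam := lam) hω.1 q v
    have hpu := two_mul_sum_residual_eq (lam := lam) hω.1 p fun i a => u (i, a)
    simp only [hequilp _ _, mul_zero, Finset.sum_const_zero, hcyl] at hpu
    have h0 : ∑ i, ∑ j, ω i j * ∑ a, (p i a - p j a) * (u (i, a) - u (j, a)) =
        ∑ i, ∑ j, ω i j * ∑ a, (q i a - q j a) * (v i a - v j a) := by
      refine Finset.sum_congr rfl fun i _ => Finset.sum_congr rfl fun j _ => ?_
      by_cases hij : G.Adj i j
      · rw [hedge i j hij]
      · simp [hω.2 i j hij]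
    rw [h0, ← hqv] at hpu
    linarith
  intro i a
  rw [Finset.sum_eq_zero_iff_of_nonneg
    fun a _ => Finset.sum_nonneg fun i _ => mul_self_nonneg _] at hsum
  have hi := hsum a (Finset.mem_univ a)
  rw [Finset.sum_eq_zero_iff_of_nonneg fun i _ => mul_self_nonneg _] at hi
  exact mul_self_eq_zero.1 (hi i (Finset.mem_univ i))

theorem stressMatY_mulVec_apply (hω : ∀ i, ω i i = 0) (w : Fin 3 × Fin n → ℝ) (a : Fin 3)
    (i : Fin n) : (stressMatY ω lam).mulVec w (a, i) =
      (∑ j, ω i j * (w (a, i) - w (a, j))) + lam i * (if a = 2 then 0 else w (a, i)) := by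
  have hΩ : ∀ j, omegaMat ω i j * w (a, j) =
      (if i = j then (∑ k, ω i k) * w (a, i) else 0) - ω i j * w (a, j) := by
    intro j
    by_cases h : i = j
    · subst h
      simp [omegaMat, hω]
    · simp [omegaMat, h]
  have hΛ : ∀ j, (if i = j ∧ a ≠ 2 then lam i else 0) * w (a, j) =
      if i = j then lam i * (if a = 2 then 0 else w (a, i)) else 0 := by
    intro j
    by_cases h : i = j
    · subst h
      by_cases ha : a = 2 <;> simp [ha]
    · simp [h]
  rw [Matrix.mulVec, dotProduct, Fintype.sum_prod_type, Finset.sum_eq_single a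
    (fun b _ hb => by simp [stressMatY, hb.symm]) (by simp)]
  simp only [stressMatY, if_true, add_mul, hΩ, hΛ, Finset.sum_add_distrib, Finset.sum_sub_distrib,
    Finset.sum_ite_eq, Finset.mem_univ, mul_sub, Finset.sum_mul]

/-- The rows of the configuration matrix of a framework lie in the kernel of its stress matrix. -/
theorem IsEquilStressY.mulVec_configMatY (h : IsEquilStressY p ω lam) (hω : ∀ i, ω i i = 0)
    (r : Fin 6) : (stressMatY ω lam).mulVec ((configMatY p).row r) = 0 := by
  ext ⟨a, i⟩
  rw [stressMatY_mulVec_apply hω]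
  have h0 := h i 0
  have h1 := h i 1
  have h2 := h i 2
  fin_cases r <;> fin_cases a <;> simp_all [configMatY, Matrix.row]

theorem AlgebraicIndependent.mul_ne_mul_of_ne
    (hgen : AlgebraicIndependent ℚ (fun c : Fin n × Fin 3 => p c.1 c.2)) {i j : Fin n}
    (hij : i ≠ j) : p i 0 * p j 1 - p j 0 * p i 1 ≠ 0 := by
  intro h
  have hP := (algebraicIndependent_iff.1 hgen)
    (MvPolynomial.X (i, 0) * MvPolynomial.X (j, 1) - MvPolynomial.X (j, 0) * MvPolynomial.X (i, 1))
    (by simpa using h)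
  have := congrArg (MvPolynomial.eval fun c => if c = (i, 0) ∨ c = (j, 1) then (1 : ℚ) else 0) hP
  simp [hij, hij.symm] at this

theorem AlgebraicIndependent.coord_ne_of_ne
    (hgen : AlgebraicIndependent ℚ (fun c : Fin n × Fin 3 => p c.1 c.2)) {i j : Fin n}
    (hij : i ≠ j) (a : Fin 3) : p i a - p j a ≠ 0 := by
  intro h
  have := hgen.injective (a₁ := (i, a)) (a₂ := (j, a)) (sub_eq_zero.1 h)
  exact hij (Prod.ext_iff.1 this).1

theorem linearIndependent_configMatY
    (hgen : AlgebraicIndependent ℚ (fun c : Fin n × Fin 3 => p c.1 c.2)) {i j : Fin n}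
    (hij : i ≠ j) : LinearIndependent ℝ (configMatY p).row := by
  rw [Fintype.linearIndependent_iff]
  intro g hg
  have hd := hgen.mul_ne_mul_of_ne hij
  have hz := hgen.coord_ne_of_ne hij 2
  have e : ∀ a k, (∑ r, g r • (configMatY p).row r) (a, k) = 0 := fun a k => by rw [hg]; rfl
  simp only [Finset.sum_apply, Pi.smul_apply, smul_eq_mul, Fin.sum_univ_six] at e
  have e0i := e 0 i
  have e0j := e 0 j
  have e1i := e 1 i
  have e1j := e 1 j
  have e2i := e 2 i
  have e2j := e 2 j
  simp [configMatY, Matrix.row] at e0i e0j e1i e1j e2i e2j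
  have g0 : g 0 = 0 := by
    refine (mul_eq_zero.1 ?_).resolve_right hd
    linear_combination p j 1 * e0i - p i 1 * e0j
  have g3 : g 3 = 0 := by
    refine (mul_eq_zero.1 ?_).resolve_right hd
    linear_combination p i 0 * e0j - p j 0 * e0i
  have g4 : g 4 = 0 := by
    refine (mul_eq_zero.1 ?_).resolve_right hd
    linear_combination p j 1 * e1i - p i 1 * e1j
  have g1 : g 1 = 0 := by
    refine (mul_eq_zero.1 ?_).resolve_right hd
    linear_combination p i 0 * e1j - p j 0 * e1i
  have g2 : g 2 = 0 := by
    refine (mul_eq_zero.1 ?_).resolve_right hz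
    linear_combination e2i - e2j
  have g5 : g 5 = 0 := by simpa [g2] using e2i
  intro r
  fin_cases r <;> assumption

/-- If the stress matrix has rank `3n - 6`, its kernel is the row space of the configuration
matrix. -/
theorem IsEquilStressY.mem_span_configMatY (hn : 2 ≤ n)
    (hgen : AlgebraicIndependent ℚ (fun c : Fin n × Fin 3 => p c.1 c.2))
    (h : IsEquilStressY p ω lam) (hω : ∀ i, ω i i = 0)
    (hrank : (stressMatY ω lam).rank = 3 * n - 6) {w : Fin 3 × Fin n → ℝ}
    (hw : (stressMatY ω lam).mulVec w = 0) :
    ∃ c : Fin 6 → ℝ, ∑ r, c r • (configMatY p).row r = w := by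
  rw [← Submodule.mem_span_range_iff_exists_fun]
  have hle : Submodule.span ℝ (Set.range (configMatY p).row) ≤
      LinearMap.ker (stressMatY ω lam).mulVecLin := by
    rw [Submodule.span_le]
    rintro _ ⟨r, rfl⟩
    exact h.mulVec_configMatY hω r
  have hLI := linearIndependent_configMatY hgen
    (i := ⟨0, by omega⟩) (j := ⟨1, by omega⟩) (by simp)
  have hnull := (stressMatY ω lam).mulVecLin.finrank_range_add_finrank_ker
  rw [← Matrix.rank, hrank] at hnull
  simp only [Module.finrank_fintype_fun_eq_card, Fintype.card_prod, Fintype.card_fin] at hnull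
  rw [Submodule.eq_of_le_of_finrank_eq hle
    (by rw [finrank_span_eq_card hLI, Fintype.card_fin]; omega)]
  exact hw

/-- A binary quadratic form vanishing at three generic points of the plane is zero. -/
theorem quadratic_coeffs_eq_zero
    (hgen : AlgebraicIndependent ℚ (fun c : Fin n × Fin 3 => p c.1 c.2)) {i j k : Fin n}
    (hij : i ≠ j) (hik : i ≠ k) (hjk : j ≠ k) {a b c : ℝ}
    (h : ∀ i, a * p i 0 ^ 2 + b * (p i 0 * p i 1) + c * p i 1 ^ 2 = 0) :
    a = 0 ∧ b = 0 ∧ c = 0 := by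
  have hd := mul_ne_zero (mul_ne_zero (hgen.mul_ne_mul_of_ne hij) (hgen.mul_ne_mul_of_ne hik))
    (hgen.mul_ne_mul_of_ne hjk)
  have hi := h i
  have hj := h j
  have hk := h k
  refine ⟨(mul_eq_zero.1 ?_).resolve_right hd, (mul_eq_zero.1 ?_).resolve_right hd,
    (mul_eq_zero.1 ?_).resolve_right hd⟩
  · linear_combination
      p j 1 * p k 1 * (p j 0 * p k 1 - p k 0 * p j 1) * hi
      - p i 1 * p k 1 * (p i 0 * p k 1 - p k 0 * p i 1) * hj
      + p i 1 * p j 1 * (p i 0 * p j 1 - p j 0 * p i 1) * hk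
  · linear_combination
      -(p j 0 ^ 2 * p k 1 ^ 2 - p k 0 ^ 2 * p j 1 ^ 2) * hi
      + (p i 0 ^ 2 * p k 1 ^ 2 - p k 0 ^ 2 * p i 1 ^ 2) * hj
      - (p i 0 ^ 2 * p j 1 ^ 2 - p j 0 ^ 2 * p i 1 ^ 2) * hk
  · linear_combination
      p j 0 * p k 0 * (p j 0 * p k 1 - p k 0 * p j 1) * hi
      - p i 0 * p k 0 * (p i 0 * p k 1 - p k 0 * p i 1) * hj
      + p i 0 * p j 0 * (p i 0 * p j 1 - p j 0 * p i 1) * hk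

end CylinderStress

theorem stmt12 (n : ℕ) (hn : 5 ≤ n) (G : SimpleGraph (Fin n))
    (p : Fin n → Fin 3 → ℝ)
    (hgen : AlgebraicIndependent ℚ (fun c : Fin n × Fin 3 => p c.1 c.2))
    (ω : Fin n → Fin n → ℝ) (lam : Fin n → ℝ) (hω : IsStress G ω)
    (hequilp : IsEquilStressY p ω lam)
    (q : Fin n → Fin 3 → ℝ)
    (hq : ∀ i, (q i 0) ^ 2 + (q i 1) ^ 2 = (p i 0) ^ 2 + (p i 1) ^ 2)
    (hequiv : ∀ i j, G.Adj i j →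
      ∑ a, (p i a - p j a) ^ 2 = ∑ a, (q i a - q j a) ^ 2) :
    IsEquilStressY q ω lam ∧
    ((stressMatY ω lam).rank = 3 * n - 6 →
      ∀ q' : Fin n → Fin 3 → ℝ,
        (∀ i, (q' i 0) ^ 2 + (q' i 1) ^ 2 = (p i 0) ^ 2 + (p i 1) ^ 2) →
        (∀ i j, G.Adj i j →
          ∑ a, (p i a - p j a) ^ 2 = ∑ a, (q' i a - q' j a) ^ 2) →
        ∀ i j, ∑ a, (p i a - p j a) ^ 2 = ∑ a, (q' i a - q' j a) ^ 2) := by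
  have hω0 : ∀ i, ω i i = 0 := fun i => hω.2 i i G.irrefl
  refine ⟨hequilp.of_equivalent hgen hω hq hequiv, fun hrank q' hq' hequiv' => ?_⟩
  have hequilq' := hequilp.of_equivalent hgen hω hq' hequiv'
  have hspan : ∀ r, ∃ c : Fin 6 → ℝ, ∑ s, c s • (configMatY p).row s = (configMatY q').row r := fun r =>
    hequilp.mem_span_configMatY (by omega) hgen hω0 hrank (hequilq'.mulVec_configMatY hω0 r)
  let i₀ : Fin n := ⟨0, by omega⟩
  let i₁ : Fin n := ⟨1, by omega⟩
  let i₂ : Fin n := ⟨2, by omega⟩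
  have h01 : i₀ ≠ i₁ := by simp [i₀, i₁]
  have h02 : i₀ ≠ i₂ := by simp [i₀, i₂]
  have h12 : i₁ ≠ i₂ := by simp [i₁, i₂]
  obtain ⟨c, hc⟩ := hspan 0
  obtain ⟨d, hd⟩ := hspan 3
  obtain ⟨e, he⟩ := hspan 2
  have hx : ∀ i, q' i 0 = c 0 * p i 0 + c 3 * p i 1 := fun i => by
    simpa [configMatY, Matrix.row, Fin.sum_univ_six] using (congrFun hc (0, i)).symm
  have hy : ∀ i, q' i 1 = d 0 * p i 0 + d 3 * p i 1 := fun i => by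
    simpa [configMatY, Matrix.row, Fin.sum_univ_six] using (congrFun hd (0, i)).symm
  have hz : ∀ i, q' i 2 = e 2 * p i 2 + e 5 := fun i => by
    simpa [configMatY, Matrix.row, Fin.sum_univ_six] using (congrFun he (2, i)).symm
  obtain ⟨h1, h2, h3⟩ := quadratic_coeffs_eq_zero hgen h01 h02 h12
    (a := c 0 ^ 2 + d 0 ^ 2 - 1) (b := 2 * (c 0 * c 3 + d 0 * d 3)) (c := c 3 ^ 2 + d 3 ^ 2 - 1)
    (fun i => by
      have := hq' i
      rw [hx, hy] at this
      linear_combination this)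
  have hplane : ∀ i j, (q' i 0 - q' j 0) ^ 2 + (q' i 1 - q' j 1) ^ 2 =
      (p i 0 - p j 0) ^ 2 + (p i 1 - p j 1) ^ 2 := fun i j => by
    rw [hx, hx, hy, hy]
    linear_combination (p i 0 - p j 0) ^ 2 * h1 +
      (p i 0 - p j 0) * (p i 1 - p j 1) * h2 + (p i 1 - p j 1) ^ 2 * h3
  obtain ⟨i, j, hij⟩ : ∃ i j, G.Adj i j := by
    by_contra! hG
    obtain ⟨f, hf⟩ := hequilp.mem_span_configMatY (by omega) hgen hω0 hrank
      (w := fun b => if b = (2, i₀) then 1 else 0) (by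
        ext ⟨a, i⟩
        rw [stressMatY_mulVec_apply hω0]
        by_cases ha : a = 2 <;> simp [hω.2 _ _ (hG _ _), ha])
    have hf' : ∀ i, f 2 * p i 2 + f 5 = if i = i₀ then 1 else 0 := fun i => by
      simpa [configMatY, Matrix.row, Fin.sum_univ_six] using congrFun hf (2, i)
    have f0 := hf' i₀
    have f1 := hf' i₁
    have f2 := hf' i₂
    rw [if_pos rfl] at f0
    rw [if_neg h01.symm] at f1
    rw [if_neg h02.symm] at f2
    have hf2 : f 2 = 0 := by
      refine (mul_eq_zero.1 ?_).resolve_right (hgen.coord_ne_of_ne h12 2)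
      linear_combination f1 - f2
    rw [hf2] at f0 f1
    linarith
  have he2 : e 2 ^ 2 = 1 := by
    have hij' := hequiv' i j hij
    simp only [Fin.sum_univ_three, hplane, hz] at hij'
    refine sub_eq_zero.1 ((mul_eq_zero.1 ?_).resolve_right
      (pow_ne_zero 2 (hgen.coord_ne_of_ne hij.ne 2)))
    linear_combination -hij'
  intro i j
  simp only [Fin.sum_univ_three, hplane, hz]
  linear_combination -(p i 2 - p j 2) ^ 2 * he2
end

section
/- Let (G,p) be a generic framework on a family of concentric cylinders Y with n ≥ 3 vertices. Let G' = (V',E') be a 1-extension of G obtained by deleting an edge e = v_1v_2 and adding a new vertex v_0 and new edges v_0v_1, v_0v_2, v_0v_3. Then there exists a map q : V' → ℝ³ such that rank R_{Y^q}(G',q) = rank R_Y(G,p) + 3, where Y^q is the family of concentric cylinders induced by q. Furthermore, if (ω,λ) is an equilibrium stress for (G,p) on Y with ω(e) ≠ 0, then there exists an equilibrium stress (ω',λ') for (G',q) on Y^q such that rank Ω_{Y^q}(ω',λ') = rank Ω_Y(ω,λ) + 3. -/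
open Finset

/-- The rigidity matrix `R_Y(G,p)` of a framework on a family of concentric cylinders:
rows indexed by (potential) edges and by vertices, columns by `Fin 3 × Fin n`
(coordinate block × vertex).  The row of an edge `v_iv_j` carries `p_i − p_j` in the
columns of `v_i` and `p_j − p_i` in the columns of `v_j`; the row of a vertex `v_i`
carries `(x_i, y_i, 0)` in the columns of `v_i`.  Rows indexed by non-edges are zero. -/
def rigidityMatY {n : ℕ} (G : SimpleGraph (Fin n)) [DecidableRel G.Adj]
    (p : Fin n → Fin 3 → ℝ) : Matrix (Sym2 (Fin n) ⊕ Fin n) (Fin 3 × Fin n) ℝ :=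
  fun row c =>
    match row with
    | Sum.inl e =>
        if e ∈ G.edgeSet then
          if h : c.2 ∈ e then p c.2 c.1 - p (Sym2.Mem.other' h) c.1 else 0
        else 0
    | Sum.inr i => if c.2 = i ∧ c.1 ≠ 2 then p i c.1 else 0

/-- The configuration `p` is generic on the family of concentric cylinders with
radii-squares `r`: the transcendence degree of `ℚ(r,p)` over `ℚ(r)` equals `2n`, expressed
by the existence of a transcendence basis of size `2n` among the coordinates of `p`. -/
def IsGenericConf (n : ℕ) (r : Fin n → ℝ) (p : Fin n → Fin 3 → ℝ) : Prop :=
  ∃ T : Finset ℝ,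
    (↑T : Set ℝ) ⊆ Set.range (fun c : Fin n × Fin 3 => p c.1 c.2) ∧
    T.card = 2 * n ∧
    AlgebraicIndependent (IntermediateField.adjoin ℚ (Set.range r)) ((↑) : T → ℝ) ∧
    ∀ (i : Fin n) (a : Fin 3), IsAlgebraic
      (IntermediateField.adjoin (IntermediateField.adjoin ℚ (Set.range r)) (↑T : Set ℝ))
      (p i a)

/-- `G'` (on vertex set `{v_0} ∪ {v_1,…,v_n}`, the new vertex `v_0` being `0` and the old
vertex `v_i` being `i.succ`) is the 1-extension of `G` deleting the edge `i1 i2` and adding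
the new vertex `v_0` joined to `i1`, `i2` and `i3`. -/
def IsOneExtension {n : ℕ} (G : SimpleGraph (Fin n)) (G' : SimpleGraph (Fin (n + 1)))
    (i1 i2 i3 : Fin n) : Prop :=
  G.Adj i1 i2 ∧ i3 ≠ i1 ∧ i3 ≠ i2 ∧
  (∀ u v : Fin n, G'.Adj u.succ v.succ ↔
    (G.Adj u v ∧ ¬((u = i1 ∧ v = i2) ∨ (u = i2 ∧ v = i1)))) ∧
  (∀ u : Fin n, G'.Adj 0 u.succ ↔ (u = i1 ∨ u = i2 ∨ u = i3))

/-- An algebraically independent finite set that is algebraic over the algebra generated by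
another finite set is no larger than it. -/
theorem AlgebraicIndependent.card_le_of_isAlgebraic_adjoin {K A : Type*} [Field K] [Field A]
    [Algebra K A] {T S : Finset A} (hT : AlgebraicIndependent K ((↑) : T → A))
    (h : ∀ x ∈ T, IsAlgebraic (Algebra.adjoin K (S : Set A)) x) : T.card ≤ S.card := by
  have hind : (AlgebraicIndependent.matroid K A).Indep (T : Set A) := hT
  have hsub : (T : Set A) ⊆ (AlgebraicIndependent.matroid K A).closure (S : Set A) := by
    rw [AlgebraicIndependent.matroid_closure_eq]
    exact fun x hx => h x hx
  have hle := hind.encard_le_eRk_of_subset hsub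
  rw [Matroid.eRk_closure_eq] at hle
  simpa using hle.trans (Matroid.eRk_le_encard _ _)

/-- For a generic configuration, each first or third coordinate lies outside some subfield closed
under square roots which contains the radii and all the other first and third coordinates. -/
theorem IsGenericConf.exists_subfield {n : ℕ} {r : Fin n → ℝ} {p : Fin n → Fin 3 → ℝ}
    (hgen : IsGenericConf n r p) (hp : ∀ i, (p i 0) ^ 2 + (p i 1) ^ 2 = r i)
    (i : Fin n) {a : Fin 3} (ha : a ≠ 1) :
    ∃ M : Subfield ℝ, p i a ∉ M ∧ (∀ j b, b ≠ 1 → (j, b) ≠ (i, a) → p j b ∈ M) ∧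
      (∀ j, r j ∈ M) ∧ ∀ x, x ^ 2 ∈ M → x ∈ M := by
  obtain ⟨T, hTp, hTcard, hTind, -⟩ := hgen
  set K := IntermediateField.adjoin ℚ (Set.range r)
  set I : Finset (Fin n × Fin 3) := univ ×ˢ {0, 2}
  have hI : ∀ c : Fin n × Fin 3, c ∈ I ↔ c.2 ≠ 1 := by
    rintro ⟨j, b⟩
    fin_cases b <;> simp [I]
  set S : Finset ℝ := (I.erase (i, a)).image (fun c => p c.1 c.2)
  have hS : S.card < 2 * n := by
    refine Finset.card_image_le.trans_lt ?_
    rw [Finset.card_erase_of_mem ((hI _).2 ha)]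
    have : I.card = 2 * n := by simp [I, mul_comm]
    have := i.pos
    omega
  let M : Subfield ℝ :=
    { carrier := {x | IsAlgebraic (Algebra.adjoin K (S : Set ℝ)) x}
      mul_mem' := IsAlgebraic.mul
      one_mem' := isAlgebraic_one
      add_mem' := IsAlgebraic.add
      zero_mem' := isAlgebraic_zero
      neg_mem' := IsAlgebraic.neg
      inv_mem' := fun _ h => h.inv }
  have hsqrt : ∀ x, x ^ 2 ∈ M → x ∈ M := fun x hx => IsAlgebraic.of_pow two_pos hx
  have hr : ∀ j, r j ∈ M := fun j =>
    isAlgebraic_algebraMap (R := Algebra.adjoin K (S : Set ℝ)) (A := ℝ)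
      (algebraMap K _ ⟨r j, IntermediateField.subset_adjoin _ _ ⟨j, rfl⟩⟩)
  have hoth : ∀ j b, b ≠ 1 → (j, b) ≠ (i, a) → p j b ∈ M := fun j b hb hne =>
    isAlgebraic_algebraMap (R := Algebra.adjoin K (S : Set ℝ)) (A := ℝ)
      ⟨p j b, Algebra.subset_adjoin (Finset.mem_coe.2 (Finset.mem_image.2
        ⟨(j, b), Finset.mem_erase.2 ⟨hne, (hI _).2 hb⟩, rfl⟩))⟩
  refine ⟨M, fun hmem => ?_, hoth, hr, hsqrt⟩
  have hne1 : ∀ j b, b ≠ 1 → p j b ∈ M := by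
    intro j b hb
    by_cases h : (j, b) = (i, a)
    · obtain ⟨rfl, rfl⟩ := Prod.mk.inj h
      exact hmem
    · exact hoth j b hb h
  have hall : ∀ j b, p j b ∈ M := by
    intro j b
    by_cases hb : b = 1
    · subst hb
      refine hsqrt _ ?_
      rw [show p j 1 ^ 2 = r j - p j 0 ^ 2 by linarith [hp j]]
      exact sub_mem (hr j) (pow_mem (hne1 j 0 (by decide)) 2)
    · exact hne1 j b hb
  have hcard := hTind.card_le_of_isAlgebraic_adjoin (S := S) (fun x hx => by
    obtain ⟨c, rfl⟩ := hTp hx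
    exact hall c.1 c.2)
  omega

/-- The determinant of the edge directions `p₁ - p₂`, `p₂ - p₃` and the normal at `p₂` does not
vanish for a generic configuration. -/
theorem IsGenericConf.det_ne_zero {n : ℕ} {r : Fin n → ℝ} {p : Fin n → Fin 3 → ℝ}
    (hgen : IsGenericConf n r p) (hr : ∀ i, 0 < r i)
    (hp : ∀ i, (p i 0) ^ 2 + (p i 1) ^ 2 = r i) {i1 i2 i3 : Fin n}
    (h12 : i1 ≠ i2) (h31 : i3 ≠ i1) (h32 : i3 ≠ i2) :
    (Matrix.of ![p i1 - p i2, p i2 - p i3, ![p i2 0, p i2 1, 0]]).det ≠ 0 := by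
  have hxy : p i2 0 * p i1 1 - p i1 0 * p i2 1 ≠ 0 := by
    intro h0
    obtain ⟨M, hnot, hmem, hrM, hsqrt⟩ := hgen.exists_subfield hp i2 (a := 0) (by decide)
    refine hnot (hsqrt _ ?_)
    have hx1 : p i1 0 ∈ M := hmem i1 0 (by decide) (by simp [h12])
    have heq : p i2 0 ^ 2 = p i1 0 ^ 2 * r i2 / r i1 := by
      rw [eq_div_iff (hr i1).ne', ← hp i1, ← hp i2]
      linear_combination (p i2 0 * p i1 1 + p i1 0 * p i2 1) * h0
    rw [heq]
    exact div_mem (mul_mem (pow_mem hx1 2) (hrM _)) (hrM _)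
  intro hdet
  obtain ⟨M, hnot, hmem, hrM, hsqrt⟩ := hgen.exists_subfield hp i3 (a := 2) (by decide)
  have hx : ∀ j, p j 0 ∈ M := fun j => hmem j 0 (by decide) (by simp)
  have hy : ∀ j, p j 1 ∈ M := by
    refine fun j => hsqrt _ ?_
    rw [show p j 1 ^ 2 = r j - p j 0 ^ 2 by linarith [hp j]]
    exact sub_mem (hrM j) (pow_mem (hx j) 2)
  have hz1 : p i1 2 ∈ M := hmem i1 2 (by decide) (by simp [h31.symm])
  have hz2 : p i2 2 ∈ M := hmem i2 2 (by decide) (by simp [h32.symm])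
  refine hnot ?_
  have heq : p i3 2 = p i2 2 + (p i1 2 - p i2 2) * (p i2 0 * p i3 1 - p i2 1 * p i3 0) /
      (p i2 0 * p i1 1 - p i1 0 * p i2 1) := by
    rw [← sub_eq_iff_eq_add', eq_div_iff hxy]
    simp [Matrix.det_fin_three] at hdet
    linear_combination -hdet
  rw [heq]
  exact add_mem hz2 (div_mem (mul_mem (sub_mem hz1 hz2)
    (sub_mem (mul_mem (hx _) (hy _)) (mul_mem (hy _) (hx _))))
    (sub_mem (mul_mem (hx _) (hy _)) (mul_mem (hx _) (hy _))))

/-- On the line through `p₁` and `p₂` there is a point, different from both, at which the two edge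
directions and the cylinder normal are linearly independent. -/
theorem exists_lineMap_det_ne_zero {p1 p2 p3 : Fin 3 → ℝ}
    (h : (Matrix.of ![p1 - p2, p2 - p3, ![p2 0, p2 1, 0]]).det ≠ 0) :
    ∃ t : ℝ, t ≠ 0 ∧ t ≠ 1 ∧ (Matrix.of ![p1 - p2, t • p1 + (1 - t) • p2 - p3,
      ![t * p1 0 + (1 - t) * p2 0, t * p1 1 + (1 - t) * p2 1, 0]]).det ≠ 0 := by
  by_contra! hcon
  have h2 := hcon 2 (by norm_num) (by norm_num)
  have h3 := hcon 3 (by norm_num) (by norm_num)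
  apply h
  simp [Matrix.det_fin_three] at h2 h3 ⊢
  linear_combination 3 * h2 - 2 * h3

theorem Matrix.existsUnique_mulVec_eq {ι K : Type*} [Fintype ι] [DecidableEq ι] [Field K]
    {N : Matrix ι ι K} (hN : N.det ≠ 0) (b : ι → K) : ∃! x, N.mulVec x = b := by
  have hu : IsUnit N.det := isUnit_iff_ne_zero.2 hN
  refine ⟨N⁻¹.mulVec b, by simp [Matrix.mulVec_mulVec, Matrix.mul_nonsing_inv _ hu], ?_⟩
  rintro x rfl
  simp [Matrix.mulVec_mulVec, Matrix.nonsing_inv_mul _ hu]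

/-- If deleting the coordinates of the vertex `0` maps the kernel of `M'` bijectively onto the
kernel of `M`, then the rank of `M'` exceeds that of `M` by three. -/
theorem Matrix.rank_eq_add_three_of_ker {n : ℕ} {α β : Type*}
    {M : Matrix α (Fin 3 × Fin n) ℝ} {M' : Matrix β (Fin 3 × Fin (n + 1)) ℝ}
    (hres : ∀ g, M'.mulVec g = 0 → M.mulVec (fun c => g (c.1, c.2.succ)) = 0)
    (hext : ∀ f, M.mulVec f = 0 → ∃! g, M'.mulVec g = 0 ∧ (fun c => g (c.1, c.2.succ)) = f) :
    M'.rank = M.rank + 3 := by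
  let L : (Fin 3 × Fin (n + 1) → ℝ) →ₗ[ℝ] (Fin 3 × Fin n → ℝ) :=
    LinearMap.funLeft ℝ ℝ (fun c => (c.1, c.2.succ))
  let L' : LinearMap.ker M'.mulVecLin →ₗ[ℝ] LinearMap.ker M.mulVecLin :=
    L.restrict (fun g hg => hres g hg)
  have hbij : Function.Bijective L' := by
    refine ⟨fun g g' h => ?_, fun f => ?_⟩
    · have hu := hext _ (hres g.1 g.2)
      exact Subtype.ext (hu.unique ⟨g.2, rfl⟩ ⟨g'.2, (congrArg Subtype.val h).symm⟩)
    · obtain ⟨g, ⟨hg, hgf⟩, -⟩ := hext f.1 f.2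
      exact ⟨⟨g, hg⟩, Subtype.ext hgf⟩
  have hker := (LinearEquiv.ofBijective L' hbij).finrank_eq
  have h1 := LinearMap.finrank_range_add_finrank_ker M.mulVecLin
  have h2 := LinearMap.finrank_range_add_finrank_ker M'.mulVecLin
  simp only [Module.finrank_fintype_fun_eq_card, Fintype.card_prod, Fintype.card_fin] at h1 h2
  rw [Matrix.rank, Matrix.rank]
  omega

theorem rigidityMatY_mulVec_inl {n : ℕ} (G : SimpleGraph (Fin n)) [DecidableRel G.Adj]
    (p : Fin n → Fin 3 → ℝ) (m : Fin 3 × Fin n → ℝ) {i j : Fin n} (hij : G.Adj i j) :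
    (rigidityMatY G p).mulVec m (Sum.inl s(i, j)) =
      ∑ a, (p i a - p j a) * (m (a, i) - m (a, j)) := by
  have hne := hij.ne
  rw [Matrix.mulVec, dotProduct, Fintype.sum_prod_type]
  refine Finset.sum_congr rfl fun a _ => ?_
  have hentry : ∀ k, rigidityMatY G p (Sum.inl s(i, j)) (a, k) =
      if k = i then p i a - p j a else if k = j then p j a - p i a else 0 := by
    intro k
    simp only [rigidityMatY, SimpleGraph.mem_edgeSet, hij, if_true]
    split_ifs with h h1 h2 h1 h2
    · subst h1
      have := Sym2.congr_right.1 (Sym2.other_spec' h)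
      rw [this]
    · subst h2
      have := Sym2.congr_right.1 ((Sym2.other_spec' h).trans Sym2.eq_swap)
      rw [this]
    · exact absurd (Sym2.mem_iff.1 h) (by simp [h1, h2])
    · exact absurd (Sym2.mem_iff.2 (Or.inl h1)) h
    · exact absurd (Sym2.mem_iff.2 (Or.inr h2)) h
    · rfl
  simp only [hentry]
  rw [Finset.sum_eq_add i j hne (by intro k _ hk; simp [hk.1, hk.2]) (by simp) (by simp)]
  simp [hne.symm]
  ring

theorem rigidityMatY_mulVec_inr {n : ℕ} (G : SimpleGraph (Fin n)) [DecidableRel G.Adj]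
    (p : Fin n → Fin 3 → ℝ) (m : Fin 3 × Fin n → ℝ) (i : Fin n) :
    (rigidityMatY G p).mulVec m (Sum.inr i) = p i 0 * m (0, i) + p i 1 * m (1, i) := by
  rw [Matrix.mulVec, dotProduct, Fintype.sum_prod_type, Fin.sum_univ_three]
  simp [rigidityMatY, ite_mul]

theorem rigidityMatY_mulVec_eq_zero_iff {n : ℕ} (G : SimpleGraph (Fin n)) [DecidableRel G.Adj]
    (p : Fin n → Fin 3 → ℝ) (m : Fin 3 × Fin n → ℝ) :
    (rigidityMatY G p).mulVec m = 0 ↔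
      (∀ i j, G.Adj i j → ∑ a, (p i a - p j a) * (m (a, i) - m (a, j)) = 0) ∧
      ∀ i, p i 0 * m (0, i) + p i 1 * m (1, i) = 0 := by
  constructor
  · intro h
    refine ⟨fun i j hij => ?_, fun i => ?_⟩
    · rw [← rigidityMatY_mulVec_inl G p m hij, h]; rfl
    · rw [← rigidityMatY_mulVec_inr G p m, h]; rfl
  · rintro ⟨h1, h2⟩
    ext e
    rcases e with e | i
    · induction e with | _ i j
      by_cases hij : G.Adj i j
      · rw [rigidityMatY_mulVec_inl G p m hij, h1 i j hij]; rfl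
      · simp [Matrix.mulVec, dotProduct, rigidityMatY, hij]
    · rw [rigidityMatY_mulVec_inr, h2]; rfl

/-- The `i`-th coordinate of `(Ω(ω) + diag μ) f`. -/
def stressForce {n : ℕ} (ω : Fin n → Fin n → ℝ) (μ : Fin n → ℝ) (f : Fin n → ℝ) (i : Fin n) : ℝ :=
  ∑ j, ω i j * (f i - f j) + μ i * f i

theorem stressMatY_mulVec {n : ℕ} {ω : Fin n → Fin n → ℝ} (hω : ∀ i, ω i i = 0)
    (lam : Fin n → ℝ) (f : Fin 3 × Fin n → ℝ) (a : Fin 3) (i : Fin n) :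
    (stressMatY ω lam).mulVec f (a, i) =
      stressForce ω (fun k => if a = 2 then 0 else lam k) (fun k => f (a, k)) i := by
  rw [Matrix.mulVec, dotProduct, Fintype.sum_prod_type,
    Finset.sum_eq_single a (by intro b _ hb; simp [stressMatY, hb.symm]) (by simp)]
  have hentry : ∀ k, stressMatY ω lam (a, i) (a, k) * f (a, k) =
      (if i = k then ((∑ l, ω i l) + if a = 2 then 0 else lam i) * f (a, i) else 0)
        - ω i k * f (a, k) := by
    intro k
    by_cases hik : i = k
    · subst hik
      by_cases ha : a = 2 <;> simp [stressMatY, omegaMat, hω, ha]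
    · simp [stressMatY, omegaMat, hik]
  simp only [hentry, Finset.sum_sub_distrib, Finset.sum_ite_eq, Finset.mem_univ, if_true,
    stressForce, mul_sub, ← Finset.sum_mul]
  ring

theorem stressMatY_mulVec_eq_zero_iff {n : ℕ} {ω : Fin n → Fin n → ℝ} (hω : ∀ i, ω i i = 0)
    (lam : Fin n → ℝ) (f : Fin 3 × Fin n → ℝ) :
    (stressMatY ω lam).mulVec f = 0 ↔ ∀ a i,
      stressForce ω (fun k => if a = 2 then 0 else lam k) (fun k => f (a, k)) i = 0 := by
  rw [funext_iff]
  simp [Prod.forall, stressMatY_mulVec hω]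

theorem isEquilStressY_iff {n : ℕ} (p : Fin n → Fin 3 → ℝ) (ω : Fin n → Fin n → ℝ)
    (lam : Fin n → ℝ) :
    IsEquilStressY p ω lam ↔ ∀ a i,
      stressForce ω (fun k => if a = 2 then 0 else lam k) (fun k => p k a) i = 0 := by
  rw [IsEquilStressY, forall_comm]
  refine forall₂_congr fun a i => ?_
  by_cases ha : a = 2 <;> simp [stressForce, ha]

/-- The weights joining the new vertex to the old ones: the edge weight `w` of `i1 i2` is split in
the ratio given by the position `t` of the new vertex on the line. -/
noncomputable def splitWeight {n : ℕ} (w t : ℝ) (i1 i2 : Fin n) (v : Fin n) : ℝ :=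
  (if v = i1 then w / (1 - t) else 0) + (if v = i2 then w / t else 0)

/-- The edge weights of the 1-extension when the new vertex subdivides the edge `i1 i2`. -/
noncomputable def extendStress {n : ℕ} (ω : Fin n → Fin n → ℝ) (t : ℝ) (i1 i2 : Fin n)
    (u v : Fin (n + 1)) : ℝ :=
  Fin.cases (Fin.cases 0 (splitWeight (ω i1 i2) t i1 i2) v)
    (fun u' => Fin.cases (splitWeight (ω i1 i2) t i1 i2 u')
      (fun v' => if (u' = i1 ∧ v' = i2) ∨ (u' = i2 ∧ v' = i1) then 0 else ω u' v') v) u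

theorem isStress_extendStress {n : ℕ} {G : SimpleGraph (Fin n)} {G' : SimpleGraph (Fin (n + 1))}
    {i1 i2 i3 : Fin n} (hext : IsOneExtension G G' i1 i2 i3) {ω : Fin n → Fin n → ℝ}
    (hω : IsStress G ω) (t : ℝ) : IsStress G' (extendStress ω t i1 i2) := by
  obtain ⟨-, -, -, hold, hnew⟩ := hext
  have hzero : ∀ u, ¬ G'.Adj 0 u.succ → splitWeight (ω i1 i2) t i1 i2 u = 0 := by
    intro u hu
    rw [hnew, not_or, not_or] at hu
    simp [splitWeight, hu.1, hu.2.1]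
  constructor
  · intro u v
    cases u using Fin.cases <;> cases v using Fin.cases <;> simp [extendStress]
    rename_i u v
    rw [hω.1 u v]
    congr 1
    simp only [eq_iff_iff]
    tauto
  · intro u v huv
    cases u using Fin.cases with
    | zero =>
      cases v using Fin.cases with
      | zero => rfl
      | succ v => exact hzero v huv
    | succ u =>
      cases v using Fin.cases with
      | zero => exact hzero u (fun h => huv h.symm)
      | succ v =>
        rw [hold] at huv
        simp only [extendStress, Fin.cases_succ]
        split_ifs with h
        · rfl
        · exact hω.2 u v (fun h' => huv ⟨h', h⟩)

theorem sum_splitWeight_mul {n : ℕ} (w t : ℝ) (i1 i2 : Fin n) (f : Fin n → ℝ) :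
    ∑ v, splitWeight w t i1 i2 v * f v = w / (1 - t) * f i1 + w / t * f i2 := by
  simp [splitWeight, add_mul, Finset.sum_add_distrib, ite_mul]

theorem stressForce_extendStress_zero {n : ℕ} (ω : Fin n → Fin n → ℝ) {t : ℝ} (ht0 : t ≠ 0)
    (ht1 : t ≠ 1) (i1 i2 : Fin n) {μ : Fin (n + 1) → ℝ} (hμ : μ 0 = 0) (g : Fin (n + 1) → ℝ) :
    stressForce (extendStress ω t i1 i2) μ g 0 =
      ω i1 i2 / (t * (1 - t)) * (g 0 - (t * g i1.succ + (1 - t) * g i2.succ)) := by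
  have h1 : 1 - t ≠ 0 := sub_ne_zero.2 ht1.symm
  have hsum := sum_splitWeight_mul (ω i1 i2) t i1 i2 (fun v => g 0 - g v.succ)
  rw [stressForce, Fin.sum_univ_succ, hμ]
  simp only [extendStress, Fin.cases_zero, Fin.cases_succ, sub_self, mul_zero, hsum]
  field_simp
  ring

theorem stressForce_extendStress_succ {n : ℕ} {ω : Fin n → Fin n → ℝ}
    (hsymm : ∀ i j, ω i j = ω j i) {t : ℝ} (ht0 : t ≠ 0)
    (ht1 : t ≠ 1) {i1 i2 : Fin n} (h12 : i1 ≠ i2) (μ : Fin (n + 1) → ℝ) (g : Fin (n + 1) → ℝ)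
    (hg : g 0 = t * g i1.succ + (1 - t) * g i2.succ) (u : Fin n) :
    stressForce (extendStress ω t i1 i2) μ g u.succ =
      stressForce ω (fun k => μ k.succ) (fun k => g k.succ) u := by
  have h1 : 1 - t ≠ 0 := sub_ne_zero.2 ht1.symm
  have hentry : ∀ v, (if (u = i1 ∧ v = i2) ∨ (u = i2 ∧ v = i1) then 0 else ω u v) *
      (g u.succ - g v.succ) = ω u v * (g u.succ - g v.succ) -
        ((if v = i2 then (if u = i1 then ω i1 i2 * (g i1.succ - g i2.succ) else 0) else 0) +
        (if v = i1 then (if u = i2 then ω i1 i2 * (g i2.succ - g i1.succ) else 0) else 0)) := by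
    intro v
    by_cases hu1 : u = i1
    · subst hu1
      by_cases hv : v = i2
      · subst hv; simp [h12]
      · simp [hv, h12]
    · by_cases hu2 : u = i2
      · subst hu2
        by_cases hv : v = i1
        · subst hv; simp [h12, hsymm u v]
        · simp [hv, hu1]
      · simp [hu1, hu2]
  rw [stressForce, stressForce, Fin.sum_univ_succ]
  simp only [extendStress, Fin.cases_zero, Fin.cases_succ, hentry, Finset.sum_sub_distrib,
    Finset.sum_add_distrib, Finset.sum_ite_eq', Finset.mem_univ, if_true, hg, splitWeight]
  by_cases hu1 : u = i1
  · subst hu1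
    simp only [h12, if_true, if_false]
    field_simp
    ring
  · by_cases hu2 : u = i2
    · subst hu2
      simp only [hu1, if_true, if_false]
      field_simp
      ring
    · simp only [hu1, hu2, if_false]
      ring

theorem stressForce_extendStress_eq_zero_iff {n : ℕ} {ω : Fin n → Fin n → ℝ}
    (hsymm : ∀ i j, ω i j = ω j i) {t : ℝ} (ht0 : t ≠ 0) (ht1 : t ≠ 1) {i1 i2 : Fin n}
    (h12 : i1 ≠ i2) (hw : ω i1 i2 ≠ 0) {μ : Fin (n + 1) → ℝ} (hμ : μ 0 = 0)
    (g : Fin (n + 1) → ℝ) :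
    (∀ u, stressForce (extendStress ω t i1 i2) μ g u = 0) ↔
      g 0 = t * g i1.succ + (1 - t) * g i2.succ ∧
        ∀ u, stressForce ω (fun k => μ k.succ) (fun k => g k.succ) u = 0 := by
  have hc : ω i1 i2 / (t * (1 - t)) ≠ 0 :=
    div_ne_zero hw (mul_ne_zero ht0 (sub_ne_zero.2 ht1.symm))
  rw [Fin.forall_fin_succ, stressForce_extendStress_zero ω ht0 ht1 i1 i2 hμ, mul_eq_zero,
    or_iff_right hc, sub_eq_zero]
  refine and_congr_right fun hg => forall_congr' fun u => ?_
  rw [stressForce_extendStress_succ hsymm ht0 ht1 h12 μ g hg]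

/-- The placement of the 1-extension which keeps the old vertices and puts the new one on the line
through `p i1` and `p i2`. -/
def extendConf {n : ℕ} (p : Fin n → Fin 3 → ℝ) (t : ℝ) (i1 i2 : Fin n) :
    Fin (n + 1) → Fin 3 → ℝ :=
  fun u a => Fin.cases (t * p i1 a + (1 - t) * p i2 a) (fun v => p v a) u

theorem exists_stress_extendConf {n : ℕ} {G : SimpleGraph (Fin n)}
    {G' : SimpleGraph (Fin (n + 1))} {i1 i2 i3 : Fin n} (hext : IsOneExtension G G' i1 i2 i3)
    {p : Fin n → Fin 3 → ℝ} {t : ℝ} (ht0 : t ≠ 0) (ht1 : t ≠ 1) {ω : Fin n → Fin n → ℝ}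
    {lam : Fin n → ℝ} (hω : IsStress G ω) (hequil : IsEquilStressY p ω lam) (hw : ω i1 i2 ≠ 0) :
    ∃ (ω' : Fin (n + 1) → Fin (n + 1) → ℝ) (lam' : Fin (n + 1) → ℝ),
      IsStress G' ω' ∧ IsEquilStressY (extendConf p t i1 i2) ω' lam' ∧
      (stressMatY ω' lam').rank = (stressMatY ω lam).rank + 3 := by
  have h12 : i1 ≠ i2 := hext.1.ne
  have hω' := isStress_extendStress hext hω t
  let lam' : Fin (n + 1) → ℝ := Fin.cons 0 lam
  have hiff := fun (a : Fin 3) (g : Fin (n + 1) → ℝ) =>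
    stressForce_extendStress_eq_zero_iff hω.1 ht0 ht1 h12 hw
      (μ := fun k => if a = 2 then 0 else lam' k) (by simp [lam']) g
  simp only [lam', Fin.cons_succ] at hiff
  have hdiag : ∀ i, ω i i = 0 := fun i => hω.2 i i (G.loopless.irrefl i)
  have hdiag' : ∀ i, extendStress ω t i1 i2 i i = 0 := fun i => hω'.2 i i (G'.loopless.irrefl i)
  refine ⟨extendStress ω t i1 i2, lam', hω', ?_, ?_⟩
  · rw [isEquilStressY_iff] at hequil ⊢
    exact fun a => (hiff a _).2 ⟨rfl, hequil a⟩
  · have hker : ∀ g, (stressMatY (extendStress ω t i1 i2) lam').mulVec g = 0 ↔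
        (∀ a, g (a, 0) = t * g (a, i1.succ) + (1 - t) * g (a, i2.succ)) ∧
          (stressMatY ω lam).mulVec (fun c => g (c.1, c.2.succ)) = 0 := by
      intro g
      rw [stressMatY_mulVec_eq_zero_iff hdiag', stressMatY_mulVec_eq_zero_iff hdiag,
        ← forall_and]
      exact forall_congr' fun a => hiff a _
    refine Matrix.rank_eq_add_three_of_ker (fun g hg => ((hker g).1 hg).2) fun f hf => ?_
    let g₀ : Fin 3 × Fin (n + 1) → ℝ := fun c =>
      Fin.cases (t * f (c.1, i1) + (1 - t) * f (c.1, i2)) (fun v => f (c.1, v)) c.2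
    refine ⟨g₀, ⟨(hker g₀).2 ⟨fun a => rfl, hf⟩, rfl⟩, ?_⟩
    rintro g ⟨hg, rfl⟩
    ext ⟨a, u⟩
    cases u using Fin.cases with
    | zero => exact ((hker g).1 hg).1 a
    | succ u => rfl

theorem rigidityMatY_extendConf_mulVec_eq_zero_iff {n : ℕ} {G : SimpleGraph (Fin n)}
    [DecidableRel G.Adj] {G' : SimpleGraph (Fin (n + 1))} [DecidableRel G'.Adj] {i1 i2 i3 : Fin n}
    (hext : IsOneExtension G G' i1 i2 i3) (p : Fin n → Fin 3 → ℝ) {t : ℝ} (ht0 : t ≠ 0)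
    (ht1 : t ≠ 1) (g : Fin 3 × Fin (n + 1) → ℝ) :
    (rigidityMatY G' (extendConf p t i1 i2)).mulVec g = 0 ↔
      (rigidityMatY G p).mulVec (fun c => g (c.1, c.2.succ)) = 0 ∧
      (Matrix.of ![p i1 - p i2, t • p i1 + (1 - t) • p i2 - p i3,
        ![t * p i1 0 + (1 - t) * p i2 0, t * p i1 1 + (1 - t) * p i2 1, 0]]).mulVec
          (fun a => g (a, 0)) =
        ![∑ a, (p i1 a - p i2 a) * g (a, i1.succ),
          ∑ a, (t * p i1 a + (1 - t) * p i2 a - p i3 a) * g (a, i3.succ), 0] := by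
  obtain ⟨hadj, h31, h32, hold, hnew⟩ := hext
  have h1 : 1 - t ≠ 0 := sub_ne_zero.2 ht1.symm
  rw [rigidityMatY_mulVec_eq_zero_iff, rigidityMatY_mulVec_eq_zero_iff, funext_iff,
    Fin.forall_fin_succ (P := fun i => extendConf p t i1 i2 i 0 * g (0, i) +
      extendConf p t i1 i2 i 1 * g (1, i) = 0)]
  simp only [Fin.forall_fin_succ (n := 2), Fin.forall_fin_succ (n := 1),
    Fin.forall_fin_succ (n := 0), Matrix.mulVec, dotProduct, Fin.sum_univ_three]
  simp [extendConf]
  constructor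
  · rintro ⟨hE, h0, hv⟩
    have e1 := hE 0 i1.succ ((hnew _).2 (by simp))
    have e2 := hE 0 i2.succ ((hnew _).2 (by simp))
    have e3 := hE 0 i3.succ ((hnew _).2 (by simp))
    simp at e1 e2 e3
    have e1' : (p i1 0 - p i2 0) * (g (0, 0) - g (0, i1.succ)) +
        (p i1 1 - p i2 1) * (g (1, 0) - g (1, i1.succ)) +
        (p i1 2 - p i2 2) * (g (2, 0) - g (2, i1.succ)) = 0 := by
      apply mul_left_cancel₀ h1
      linear_combination -e1
    have e2' : (p i1 0 - p i2 0) * (g (0, 0) - g (0, i2.succ)) +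
        (p i1 1 - p i2 1) * (g (1, 0) - g (1, i2.succ)) +
        (p i1 2 - p i2 2) * (g (2, 0) - g (2, i2.succ)) = 0 := by
      apply mul_left_cancel₀ ht0
      linear_combination e2
    refine ⟨⟨fun i j hij => ?_, hv⟩, ?_, ?_, h0⟩
    · by_cases hc : (i = i1 ∧ j = i2) ∨ (i = i2 ∧ j = i1)
      · rcases hc with ⟨rfl, rfl⟩ | ⟨rfl, rfl⟩ <;> linear_combination e2' - e1'
      · simpa using hE i.succ j.succ ((hold _ _).2 ⟨hij, hc⟩)
    · linear_combination e1'
    · linear_combination e3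
  · rintro ⟨⟨hE, hv⟩, f1, f3, h0⟩
    have e12 := hE i1 i2 hadj
    have hE0 : ∀ u, G'.Adj 0 u.succ →
        (t * p i1 0 + (1 - t) * p i2 0 - p u 0) * (g (0, 0) - g (0, u.succ)) +
        (t * p i1 1 + (1 - t) * p i2 1 - p u 1) * (g (1, 0) - g (1, u.succ)) +
        (t * p i1 2 + (1 - t) * p i2 2 - p u 2) * (g (2, 0) - g (2, u.succ)) = 0 := by
      intro u hu
      rcases (hnew u).1 hu with rfl | rfl | rfl
      · linear_combination -(1 - t) * f1
      · linear_combination t * f1 + t * e12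
      · linear_combination f3
    refine ⟨fun u v huv => ?_, h0, hv⟩
    cases u using Fin.cases with
    | zero =>
      cases v using Fin.cases with
      | zero => exact absurd huv (G'.loopless.irrefl 0)
      | succ v => simpa using hE0 v huv
    | succ u =>
      cases v using Fin.cases with
      | zero =>
        simp
        linear_combination hE0 u huv.symm
      | succ v => simpa using hE u v ((hold u v).1 huv).1

theorem rank_rigidityMatY_extendConf {n : ℕ} {G : SimpleGraph (Fin n)}
    [DecidableRel G.Adj] {G' : SimpleGraph (Fin (n + 1))} [DecidableRel G'.Adj] {i1 i2 i3 : Fin n}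
    (hext : IsOneExtension G G' i1 i2 i3) (p : Fin n → Fin 3 → ℝ) {t : ℝ} (ht0 : t ≠ 0)
    (ht1 : t ≠ 1) (hdet : (Matrix.of ![p i1 - p i2, t • p i1 + (1 - t) • p i2 - p i3,
      ![t * p i1 0 + (1 - t) * p i2 0, t * p i1 1 + (1 - t) * p i2 1, 0]]).det ≠ 0) :
    (rigidityMatY G' (extendConf p t i1 i2)).rank = (rigidityMatY G p).rank + 3 := by
  have hker := rigidityMatY_extendConf_mulVec_eq_zero_iff hext p ht0 ht1
  refine Matrix.rank_eq_add_three_of_ker (fun g hg => ((hker g).1 hg).1) fun f hf => ?_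
  obtain ⟨x, hx, huniq⟩ := Matrix.existsUnique_mulVec_eq hdet
    ![∑ a, (p i1 a - p i2 a) * f (a, i1),
      ∑ a, (t * p i1 a + (1 - t) * p i2 a - p i3 a) * f (a, i3), 0]
  let g₀ : Fin 3 × Fin (n + 1) → ℝ := fun c => Fin.cases (x c.1) (fun v => f (c.1, v)) c.2
  refine ⟨g₀, ⟨(hker g₀).2 ⟨hf, hx⟩, rfl⟩, ?_⟩
  rintro g ⟨hg, rfl⟩
  ext ⟨a, u⟩
  cases u using Fin.cases with
  | zero => exact congrFun (huniq (fun a => g (a, 0)) ((hker g).1 hg).2) a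
  | succ u => rfl

theorem stmt14 (n : ℕ) (hn : 3 ≤ n) (G : SimpleGraph (Fin n)) [DecidableRel G.Adj]
    (r : Fin n → ℝ) (hr : ∀ i, 0 < r i)
    (p : Fin n → Fin 3 → ℝ) (hp : ∀ i, (p i 0) ^ 2 + (p i 1) ^ 2 = r i)
    (hgen : IsGenericConf n r p)
    (G' : SimpleGraph (Fin (n + 1))) [DecidableRel G'.Adj]
    (i1 i2 i3 : Fin n) (hext : IsOneExtension G G' i1 i2 i3) :
    ∃ q : Fin (n + 1) → Fin 3 → ℝ,
      (∀ i, ¬(q i 0 = 0 ∧ q i 1 = 0)) ∧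
      (rigidityMatY G' q).rank = (rigidityMatY G p).rank + 3 ∧
      ∀ (ω : Fin n → Fin n → ℝ) (lam : Fin n → ℝ),
        IsStress G ω → IsEquilStressY p ω lam → ω i1 i2 ≠ 0 →
        ∃ (ω' : Fin (n + 1) → Fin (n + 1) → ℝ) (lam' : Fin (n + 1) → ℝ),
          IsStress G' ω' ∧ IsEquilStressY q ω' lam' ∧
          (stressMatY ω' lam').rank = (stressMatY ω lam).rank + 3 := by
  have h12 : i1 ≠ i2 := hext.1.ne
  obtain ⟨t, ht0, ht1, hdet⟩ := exists_lineMap_det_ne_zero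
    (hgen.det_ne_zero hr hp h12 hext.2.1 hext.2.2.1)
  refine ⟨extendConf p t i1 i2, ?_, rank_rigidityMatY_extendConf hext p ht0 ht1 hdet,
    fun ω lam hω hequil hw => exists_stress_extendConf hext ht0 ht1 hω hequil hw⟩
  intro i
  cases i using Fin.cases with
  | zero =>
    rintro ⟨h0, h1⟩
    apply hdet
    simp only [extendConf, Fin.cases_zero] at h0 h1
    simp [Matrix.det_fin_three, h0, h1]
  | succ i =>
    rintro ⟨h0, h1⟩
    simp only [extendConf, Fin.cases_succ] at h0 h1
    have := hp i
    have := hr i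
    simp_all
end
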